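/- Suppose z* is a solution at which MFCQ, the second-order condition, and strict complementarity (SC) are satisfied, and fix constants C > 0, γ ∈ (0,1). Then there exist K > 0 and a neighborhood W of S such that for every (z,λ,s) with (z,λ) ∈ W, λ ≥ 0, satisfying the approximate centrality conditions with constants C, γ, one has δ(z,λ) ≤ K·μ, where μ = λᵀs/m. -/

import Mathlib

open Matrix
open scoped BigOperators

noncomputable section

attribute [local instance] Classical.propDecidable

/-- Euclidean norm of a finitely indexed family of real numbers. -/
def evnorm {ι : Type*} [Fintype ι] (v : ι → ℝ) : ℝ :=
  Real.sqrt (∑ i, v i ^ 2)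

/-- Frobenius norm of a real matrix. -/
def mnorm {ι κ : Type*} [Fintype ι] [Fintype κ] (M : Matrix ι κ ℝ) : ℝ :=
  Real.sqrt (∑ i, ∑ j, M i j ^ 2)

/-- Smallest singular value of a real matrix. -/
def sigmaMin {ι κ : Type*} [Fintype ι] [Fintype κ] (M : Matrix ι κ ℝ) : ℝ :=
  sInf {t | ∃ x : κ → ℝ, evnorm x = 1 ∧ t = evnorm (M.mulVec x)}

/-- The continuous linear functional `x ↦ ⟨v, x⟩` on `ℝⁿ`. -/
def dotCLM {n : ℕ} (v : Fin n → ℝ) : (Fin n → ℝ) →L[ℝ] ℝ :=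
  ∑ i, v i • (ContinuousLinearMap.proj (R := ℝ) (φ := fun _ : Fin n => ℝ) i)

/-- The continuous linear map `x ↦ M x` on `ℝⁿ`. -/
def matCLM {n : ℕ} (M : Matrix (Fin n) (Fin n) ℝ) : (Fin n → ℝ) →L[ℝ] (Fin n → ℝ) :=
  LinearMap.toContinuousLinearMap (Matrix.toLin' M)

/-- Duality measure `μ(λ,s) = λᵀ s / m`. -/
def dmu {m : ℕ} (lam s : Fin m → ℝ) : ℝ := (∑ i, lam i * s i) / (m : ℝ)

/-- Data of the nonlinear program `min φ(z)  s.t.  g(z) ≤ 0`, with `φ` and each `gᵢ`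
twice Lipschitz continuously differentiable; `gradphi`, `gradg` are the gradients and
`hessphi`, `hessg` the (symmetric) Hessians. -/
structure NLP (n m : ℕ) where
  phi : (Fin n → ℝ) → ℝ
  g : Fin m → (Fin n → ℝ) → ℝ
  gradphi : (Fin n → ℝ) → Fin n → ℝ
  gradg : Fin m → (Fin n → ℝ) → Fin n → ℝ
  hessphi : (Fin n → ℝ) → Matrix (Fin n) (Fin n) ℝ
  hessg : Fin m → (Fin n → ℝ) → Matrix (Fin n) (Fin n) ℝ
  grad_phi : ∀ z, HasFDerivAt phi (dotCLM (gradphi z)) z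
  grad_g : ∀ i z, HasFDerivAt (g i) (dotCLM (gradg i z)) z
  hess_phi : ∀ z, HasFDerivAt gradphi (matCLM (hessphi z)) z
  hess_g : ∀ i z, HasFDerivAt (gradg i) (matCLM (hessg i z)) z
  hessphi_symm : ∀ z, (hessphi z).IsSymm
  hessg_symm : ∀ i z, (hessg i z).IsSymm
  lip_phi : ∃ K, ∀ z z', mnorm (hessphi z - hessphi z') ≤ K * evnorm (z - z')
  lip_g : ∀ i, ∃ K, ∀ z z', mnorm (hessg i z - hessg i z') ≤ K * evnorm (z - z')

namespace NLP

variable {n m : ℕ} (P : NLP n m)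

/-- Gradient of the Lagrangian with respect to `z`:  `L_z(z,λ) = ∇φ(z) + ∇g(z)λ`. -/
def Lz (z : Fin n → ℝ) (lam : Fin m → ℝ) : Fin n → ℝ :=
  fun j => P.gradphi z j + ∑ i, lam i * P.gradg i z j

/-- Hessian of the Lagrangian with respect to `z`. -/
def Lzz (z : Fin n → ℝ) (lam : Fin m → ℝ) : Matrix (Fin n) (Fin n) ℝ :=
  P.hessphi z + ∑ i, lam i • P.hessg i z

/-- The KKT conditions at `(z, λ)`. -/
def KKT (z : Fin n → ℝ) (lam : Fin m → ℝ) : Prop :=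
  P.Lz z lam = 0 ∧ (∀ i, P.g i z ≤ 0) ∧ (∀ i, 0 ≤ lam i) ∧ (∑ i, lam i * P.g i z) = 0

/-- The set `S_λ` of optimal Lagrange multipliers at `z*`. -/
def Slam (zstar : Fin n → ℝ) : Set (Fin m → ℝ) := {lam | P.KKT zstar lam}

/-- The Mangasarian–Fromovitz constraint qualification at `z*`. -/
def MFCQ (zstar : Fin n → ℝ) : Prop :=
  ∃ ybar : Fin n → ℝ, ∀ i, P.g i zstar = 0 → (∑ j, P.gradg i zstar j * ybar j) < 0

/-- The index set `B₊` of active constraints with a positive multiplier. -/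
def BPlus (zstar : Fin n → ℝ) : Set (Fin m) :=
  {i | P.g i zstar = 0 ∧ ∃ ls ∈ P.Slam zstar, 0 < ls i}

/-- The second-order sufficient condition at `z*`. -/
def SOC (zstar : Fin n → ℝ) : Prop :=
  ∃ ξ : ℝ, 0 < ξ ∧ ∀ ls ∈ P.Slam zstar, ∀ w : Fin n → ℝ,
    (∀ i, i ∈ P.BPlus zstar → (∑ j, P.gradg i zstar j * w j) = 0) →
    (∀ i, P.g i zstar = 0 → i ∉ P.BPlus zstar → (∑ j, P.gradg i zstar j * w j) ≤ 0) →
    ξ * evnorm w ^ 2 ≤ w ⬝ᵥ (P.Lzz zstar ls).mulVec w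

/-- The strict complementarity condition `B₊ = B` at `z*`. -/
def StrictComp (zstar : Fin n → ℝ) : Prop :=
  ∀ i, P.g i zstar = 0 → i ∈ P.BPlus zstar

/-- `z*` is a solution of the nonlinear program: it is feasible, it is a local
minimizer, and the first-order KKT conditions hold there. -/
def isSolution (zstar : Fin n → ℝ) : Prop :=
  (∀ i, P.g i zstar ≤ 0) ∧ (∃ lam, P.KKT zstar lam) ∧
  ∀ᶠ z in nhds zstar, (∀ i, P.g i z ≤ 0) → P.phi zstar ≤ P.phi z

/-- Euclidean distance `δ(z,λ)` from `(z,λ)` to the primal–dual solution set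
`S = {z*} × S_λ`. -/
def delta (zstar z : Fin n → ℝ) (lam : Fin m → ℝ) : ℝ :=
  sInf {d | ∃ ls ∈ P.Slam zstar,
    d = Real.sqrt (evnorm (z - zstar) ^ 2 + evnorm (lam - ls) ^ 2)}

/-- The approximate centrality conditions with constants `C`, `γ`. -/
def central (C gam : ℝ) (z : Fin n → ℝ) (lam s : Fin m → ℝ) : Prop :=
  evnorm (P.Lz z lam) ≤ C * dmu lam s ∧
  evnorm (fun i => P.g i z + s i) ≤ C * dmu lam s ∧
  (∀ i, 0 < lam i) ∧ (∀ i, 0 < s i) ∧ (∀ i, gam * dmu lam s ≤ lam i * s i)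

/-- The active index set `B` at `z*`, as a type. -/
abbrev Bsub (zstar : Fin n → ℝ) : Type := {i : Fin m // P.g i zstar = 0}

/-- The inactive index set `N` at `z*`, as a type. -/
abbrev Nsub (zstar : Fin n → ℝ) : Type := {i : Fin m // ¬ P.g i zstar = 0}

/-- `∇g(z)`:  the `n × m` matrix whose columns are the constraint gradients. -/
def Gfull (z : Fin n → ℝ) : Matrix (Fin n) (Fin m) ℝ :=
  Matrix.of fun j i => P.gradg i z j

/-- `∇g_B(z)`:  the columns of `∇g(z)` indexed by the active set `B` at `z*`. -/
def GB (zstar z : Fin n → ℝ) : Matrix (Fin n) (P.Bsub zstar) ℝ :=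
  Matrix.of fun j b => P.gradg b.1 z j

/-- `∇g_N(z)`:  the columns of `∇g(z)` indexed by the inactive set `N` at `z*`. -/
def GN (zstar z : Fin n → ℝ) : Matrix (Fin n) (P.Nsub zstar) ℝ :=
  Matrix.of fun j b => P.gradg b.1 z j

/-- The diagonal matrix `D_B = Λ_B⁻¹ S_B`. -/
def DB (zstar : Fin n → ℝ) (lam s : Fin m → ℝ) :
    Matrix (P.Bsub zstar) (P.Bsub zstar) ℝ :=
  Matrix.diagonal fun b => s b.1 / lam b.1

/-- The diagonal matrix `D_N = Λ_N⁻¹ S_N`. -/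
def DN (zstar : Fin n → ℝ) (lam s : Fin m → ℝ) :
    Matrix (P.Nsub zstar) (P.Nsub zstar) ℝ :=
  Matrix.diagonal fun b => s b.1 / lam b.1

/-- The exact primal–dual step: the solution of the linear system (pdip.orig). -/
def exactStep (z : Fin n → ℝ) (lam s t : Fin m → ℝ) (dz : Fin n → ℝ)
    (dl ds : Fin m → ℝ) : Prop :=
  (∀ j, ((P.Lzz z lam).mulVec dz) j + ((P.Gfull z).mulVec dl) j = -(P.Lz z lam j)) ∧
  (∀ i, (((P.Gfull z)ᵀ).mulVec dz) i + ds i = -(P.g i z + s i)) ∧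
  (∀ i, s i * dl i + lam i * ds i = -(s i * lam i + t i))

end NLP

/-- Part (a) of Assumption A: `z*` is a solution at which MFCQ, the second-order
condition, and strict complementarity hold, and the current iterate `(z,λ,s)`
satisfies the approximate centrality conditions with constants `C`, `γ`. -/
def AssumptionAa {n m : ℕ} (P : NLP n m) (zstar : Fin n → ℝ) (C gam : ℝ)
    (z : Fin n → ℝ) (lam s : Fin m → ℝ) : Prop :=
  P.isSolution zstar ∧ P.MFCQ zstar ∧ P.SOC zstar ∧ P.StrictComp zstar ∧
  P.central C gam z lam s

/-- The data of a singular value decomposition `∇g_B(z*) = Û Σ Uᵀ`, where the square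
matrices `[Û V̂]` (of order `n`) and `[U V]` (of order `|B|`) are orthogonal and `Σ` is
diagonal with positive diagonal entries. -/
structure SVDdata {n m : ℕ} (P : NLP n m) (zstar : Fin n → ℝ) where
  k : ℕ
  kc : ℕ
  r : ℕ
  Uhat : Matrix (Fin n) (Fin k) ℝ
  Vhat : Matrix (Fin n) (Fin kc) ℝ
  U : Matrix (P.Bsub zstar) (Fin k) ℝ
  V : Matrix (P.Bsub zstar) (Fin r) ℝ
  sig : Fin k → ℝ
  sig_pos : ∀ j, 0 < sig j
  hUhat : Uhatᵀ * Uhat = 1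
  hVhat : Vhatᵀ * Vhat = 1
  hUVhat : Uhatᵀ * Vhat = 0
  hhat_complete : Uhat * Uhatᵀ + Vhat * Vhatᵀ = 1
  hU : Uᵀ * U = 1
  hV : Vᵀ * V = 1
  hUV : Uᵀ * V = 0
  h_complete : U * Uᵀ + V * Vᵀ = 1
  hsvd : P.GB zstar zstar = Uhat * Matrix.diagonal sig * Uᵀ

open Filter Topology

lemma abs_dotProduct_le {ι : Type*} [Fintype ι] (v w : ι → ℝ) :
    |v ⬝ᵥ w| ≤ Fintype.card ι * (‖v‖ * ‖w‖) := by
  unfold dotProduct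
  calc |∑ i, v i * w i| ≤ ∑ i, |v i * w i| := Finset.abs_sum_le_sum_abs _ _
    _ ≤ ∑ _i : ι, ‖v‖ * ‖w‖ := by
        gcongr with i
        rw [abs_mul]
        exact mul_le_mul (norm_le_pi_norm v i) (norm_le_pi_norm w i) (abs_nonneg _)
          (norm_nonneg _)
    _ = _ := by simp

lemma exists_abs_dotProduct_mulVec_le {ι : Type*} [Fintype ι] (H : Matrix ι ι ℝ) :
    ∃ M : ℝ, 0 ≤ M ∧ ∀ v w : ι → ℝ, |v ⬝ᵥ H.mulVec w| ≤ M * (‖v‖ * ‖w‖) := by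
  let T := LinearMap.toContinuousLinearMap (Matrix.toLin' H)
  refine ⟨Fintype.card ι * ‖T‖, by positivity, fun v w => ?_⟩
  have hT : ‖H.mulVec w‖ ≤ ‖T‖ * ‖w‖ := T.le_opNorm w
  calc |v ⬝ᵥ H.mulVec w| ≤ Fintype.card ι * (‖v‖ * ‖H.mulVec w‖) := abs_dotProduct_le _ _
    _ ≤ Fintype.card ι * (‖v‖ * (‖T‖ * ‖w‖)) := by gcongr
    _ = _ := by ring

lemma norm_le_evnorm {ι : Type*} [Fintype ι] (v : ι → ℝ) : ‖v‖ ≤ evnorm v := by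
  refine (pi_norm_le_iff_of_nonneg (Real.sqrt_nonneg _)).2 fun i => ?_
  refine Real.abs_le_sqrt ?_
  exact Finset.single_le_sum (f := fun i => v i ^ 2) (fun i _ => sq_nonneg _) (Finset.mem_univ i)

lemma evnorm_le_card_mul_norm {ι : Type*} [Fintype ι] (v : ι → ℝ) :
    evnorm v ≤ Fintype.card ι * ‖v‖ := by
  refine Real.sqrt_le_iff.2 ⟨by positivity, ?_⟩
  have h := (le_abs_self _).trans (abs_dotProduct_le v v)
  have h' : ∑ i, v i ^ 2 = v ⬝ᵥ v := by simp [dotProduct, sq]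
  rw [h']
  refine h.trans ?_
  have hc : (Fintype.card ι : ℝ) ≤ (Fintype.card ι : ℝ) ^ 2 := by
    exact_mod_cast Nat.le_self_pow two_ne_zero _
  nlinarith [mul_le_mul_of_nonneg_right hc (sq_nonneg ‖v‖)]

lemma dotCLM_apply {n : ℕ} (v w : Fin n → ℝ) : dotCLM v w = v ⬝ᵥ w := by
  simp [dotCLM, dotProduct]

/-- Every vector may be corrected by a preimage of controlled norm into the kernel of `A`. -/
lemma LinearMap.exists_bounded_preimage {E F : Type*} [NormedAddCommGroup E] [NormedSpace ℝ E]
    [NormedAddCommGroup F] [NormedSpace ℝ F] [FiniteDimensional ℝ F] (A : E →ₗ[ℝ] F) :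
    ∃ k : ℝ, 0 ≤ k ∧ ∀ w, ∃ q, A q = A w ∧ ‖q‖ ≤ k * ‖A w‖ := by
  obtain ⟨B, hB⟩ := A.rangeRestrict.exists_rightInverse_of_surjective A.range_rangeRestrict
  let T := LinearMap.toContinuousLinearMap B
  refine ⟨‖T‖, T.opNorm_nonneg, fun w => ⟨B (A.rangeRestrict w), ?_, ?_⟩⟩
  · have := LinearMap.congr_fun hB (A.rangeRestrict w)
    exact congrArg Subtype.val this
  · exact T.le_opNorm (A.rangeRestrict w)

lemma IsCompact.exists_eventually_nhdsSet_of_monotone {X : Type*} [TopologicalSpace X] {S : Set X}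
    (hS : IsCompact S) {Q : ℝ → X → Prop} (hQ : ∀ x K K', K ≤ K' → Q K x → Q K' x)
    (h : ∀ x ∈ S, ∃ K : ℝ, 0 < K ∧ ∀ᶠ y in 𝓝 x, Q K y) :
    ∃ K : ℝ, 0 < K ∧ ∀ᶠ y in 𝓝ˢ S, Q K y := by
  refine hS.induction_on (p := fun T => ∃ K : ℝ, 0 < K ∧ ∀ᶠ y in 𝓝ˢ T, Q K y)
    ⟨1, one_pos, by simp⟩ ?_ ?_ ?_
  · rintro T T' hT ⟨K, hK, h⟩
    exact ⟨K, hK, h.filter_mono (nhdsSet_mono hT)⟩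
  · rintro T T' ⟨K, hK, h⟩ ⟨K', hK', h'⟩
    refine ⟨max K K', lt_max_of_lt_left hK, ?_⟩
    rw [nhdsSet_union, eventually_sup]
    exact ⟨h.mono fun y => hQ y _ _ (le_max_left _ _), h'.mono fun y => hQ y _ _ (le_max_right _ _)⟩
  · intro x hx
    obtain ⟨K, hK, h⟩ := h x hx
    refine ⟨_, nhdsWithin_le_nhds (eventually_eventually_nhds.2 h), K, hK, ?_⟩
    rw [eventually_nhdsSet_iff_forall]
    exact fun y hy => hy

section Taylor

variable {n : ℕ} {f : (Fin n → ℝ) → ℝ} {f' : (Fin n → ℝ) → Fin n → ℝ}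
  {H : Matrix (Fin n) (Fin n) ℝ} {x : Fin n → ℝ}

lemma eventually_abs_gradient_sub_dotProduct_le (hH : HasFDerivAt f' (matCLM H) x)
    {ε : ℝ} (hε : 0 < ε) :
    ∀ᶠ z in 𝓝 x, ∀ w, |(f' z - f' x - H.mulVec (z - x)) ⬝ᵥ w| ≤ ε * (‖z - x‖ * ‖w‖) := by
  have h := hH.isLittleO.def (c := ε / (n + 1)) (by positivity)
  filter_upwards [h] with z hz w
  have hz' : ‖f' z - f' x - H.mulVec (z - x)‖ ≤ ε / (n + 1) * ‖z - x‖ := hz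
  calc _ ≤ (n : ℝ) * (‖f' z - f' x - H.mulVec (z - x)‖ * ‖w‖) := by
        simpa using abs_dotProduct_le (f' z - f' x - H.mulVec (z - x)) w
    _ ≤ (n + 1 : ℝ) * ((ε / (n + 1) * ‖z - x‖) * ‖w‖) := by gcongr; linarith
    _ = _ := by field_simp

lemma eventually_abs_taylor_two_le (hf : ∀ z, HasFDerivAt f (dotCLM (f' z)) z)
    (hH : HasFDerivAt f' (matCLM H) x) {ε : ℝ} (hε : 0 < ε) :
    ∀ᶠ z in 𝓝 x, |f z - f x - f' x ⬝ᵥ (z - x) - (z - x) ⬝ᵥ H.mulVec (z - x) / 2|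
      ≤ ε * ‖z - x‖ ^ 2 := by
  obtain ⟨r, hr, hball⟩ := Metric.eventually_nhds_iff.1
    (eventually_abs_gradient_sub_dotProduct_le hH hε)
  refine Metric.eventually_nhds_iff.2 ⟨r, hr, fun z hz => ?_⟩
  obtain ⟨d, hd⟩ : ∃ d, d = z - x := ⟨_, rfl⟩
  rw [dist_eq_norm] at hz
  rw [← hd] at hz ⊢
  let ψ : ℝ → ℝ := fun t => f (x + t • d) - t * (f' x ⬝ᵥ d) - t ^ 2 * (d ⬝ᵥ H.mulVec d / 2)
  have hψ : ∀ t, HasDerivAt ψ ((f' (x + t • d) - f' x - H.mulVec (t • d)) ⬝ᵥ d) t := by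
    intro t
    have h1 : HasDerivAt (fun t : ℝ => x + t • d) d t := by
      simpa using ((hasDerivAt_id t).smul_const d).const_add x
    have h2 := (hf (x + t • d)).comp_hasDerivAt t h1
    have h3 := (h2.sub ((hasDerivAt_id t).mul_const (f' x ⬝ᵥ d))).sub
      (((hasDerivAt_id t).pow 2).mul_const (d ⬝ᵥ H.mulVec d / 2))
    refine h3.congr_deriv ?_
    rw [dotCLM_apply, sub_dotProduct, sub_dotProduct, Matrix.mulVec_smul, smul_dotProduct,
      dotProduct_comm (H.mulVec d)]
    simp
    ring
  have hb : ∀ t ∈ Set.Ico (0 : ℝ) 1,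
      ‖(f' (x + t • d) - f' x - H.mulVec (t • d)) ⬝ᵥ d‖ ≤ ε * ‖d‖ ^ 2 := by
    intro t ht
    have ht' : ‖t • d‖ ≤ ‖d‖ := by
      rw [norm_smul, Real.norm_eq_abs, abs_of_nonneg ht.1]
      nlinarith [norm_nonneg d, ht.2]
    have hx : dist (x + t • d) x < r := by
      rw [dist_eq_norm, add_sub_cancel_left]
      exact ht'.trans_lt hz
    have := hball hx d
    rw [add_sub_cancel_left] at this
    refine this.trans ?_
    rw [sq]
    gcongr
  have := norm_image_sub_le_of_norm_deriv_le_segment_01'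
    (fun t _ => (hψ t).hasDerivWithinAt) hb
  have e1 : ψ 1 = f z - f' x ⬝ᵥ d - d ⬝ᵥ H.mulVec d / 2 := by simp [ψ, hd]
  have e0 : ψ 0 = f x := by simp [ψ]
  rw [e1, e0, Real.norm_eq_abs] at this
  convert this using 2
  ring

lemma eventually_trapezoid (hf : ∀ z, HasFDerivAt f (dotCLM (f' z)) z)
    (hH : HasFDerivAt f' (matCLM H) x) {ε : ℝ} (hε : 0 < ε) :
    ∀ᶠ z in 𝓝 x,
      |(f' z ⬝ᵥ (z - x) + f' x ⬝ᵥ (z - x)) / 2 - (f z - f x)| ≤ ε * ‖z - x‖ ^ 2 ∧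
      |f' z ⬝ᵥ (z - x) - f' x ⬝ᵥ (z - x) - (z - x) ⬝ᵥ H.mulVec (z - x)|
        ≤ ε * ‖z - x‖ ^ 2 := by
  filter_upwards [eventually_abs_taylor_two_le hf hH (half_pos hε),
    eventually_abs_gradient_sub_dotProduct_le hH hε] with z h1 h2
  have h2 := h2 (z - x)
  rw [sub_dotProduct, sub_dotProduct, dotProduct_comm (H.mulVec _), ← sq] at h2
  refine ⟨?_, h2⟩
  rw [abs_le] at *
  constructor <;> linarith

end Taylor

lemma exists_pos_forall_le {ι : Type*} [Finite ι] {f : ι → ℝ} (hf : ∀ i, 0 < f i) :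
    ∃ κ : ℝ, 0 < κ ∧ ∀ i, κ ≤ f i := by
  have h : ∀ᶠ κ in 𝓝[>] (0 : ℝ), ∀ i, κ ≤ f i :=
    eventually_all.2 fun i => nhdsWithin_le_nhds (eventually_le_nhds (hf i))
  obtain ⟨κ, h1, h2⟩ := (h.and self_mem_nhdsWithin).exists
  exact ⟨κ, h2, h1⟩

lemma exists_pos_mul_sq_le {c a : ℝ} (hc : 0 ≤ c) (ha : 0 < a) :
    ∃ ε : ℝ, 0 < ε ∧ c * ε ^ 2 ≤ a := by
  refine ⟨√(a / (c + 1)), by positivity, ?_⟩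
  rw [Real.sq_sqrt (by positivity), mul_div_assoc', div_le_iff₀ (by positivity)]
  nlinarith

lemma le_mul_of_mul_sq_le {a K t x : ℝ} (ha : 0 < a) (hK : 0 ≤ K) (ht : 0 ≤ t)
    (h : a / 2 * x ^ 2 ≤ K * (t * (t + x))) : x ≤ (4 * K / a + 1) * t := by
  have hKa : 0 ≤ 4 * K / a * t := by positivity
  rcases le_or_gt x t with hxt | hxt
  · linarith
  · have h1 : a / 2 * x ^ 2 ≤ K * (t * (2 * x)) := by
      refine h.trans ?_
      gcongr
      linarith
    have h2 : x ≤ 4 * K / a * t := by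
      rw [div_mul_eq_mul_div, le_div_iff₀ ha]
      refine le_of_mul_le_mul_right ?_ (ht.trans_lt hxt)
      linarith
    linarith

lemma dmu_nonneg {m : ℕ} {lam s : Fin m → ℝ} (h : ∀ i, 0 ≤ lam i) (h' : ∀ i, 0 ≤ s i) :
    0 ≤ dmu lam s :=
  div_nonneg (Finset.sum_nonneg fun i _ => mul_nonneg (h i) (h' i)) (Nat.cast_nonneg m)

lemma sum_mul_eq_mul_dmu {m : ℕ} (lam s : Fin m → ℝ) :
    ∑ i, lam i * s i = m * dmu lam s := by
  rcases Nat.eq_zero_or_pos m with rfl | hm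
  · simp
  · have : (m : ℝ) ≠ 0 := by positivity
    unfold dmu
    field_simp

namespace NLP

variable {n m : ℕ} {P : NLP n m} {zstar : Fin n → ℝ}

lemma Lz_dotProduct (z : Fin n → ℝ) (lam : Fin m → ℝ) (w : Fin n → ℝ) :
    P.Lz z lam ⬝ᵥ w = P.gradphi z ⬝ᵥ w + ∑ i, lam i * (P.gradg i z ⬝ᵥ w) := by
  have : P.Lz z lam = P.gradphi z + ∑ i, lam i • P.gradg i z := by
    ext j
    simp [Lz]
  rw [this, add_dotProduct, sum_dotProduct]
  simp

lemma dotProduct_Lzz_mulVec (z : Fin n → ℝ) (lam : Fin m → ℝ) (v w : Fin n → ℝ) :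
    v ⬝ᵥ (P.Lzz z lam).mulVec w =
      v ⬝ᵥ (P.hessphi z).mulVec w + ∑ i, lam i * (v ⬝ᵥ (P.hessg i z).mulVec w) := by
  rw [Lzz, Matrix.add_mulVec, dotProduct_add, Matrix.sum_mulVec, dotProduct_sum]
  simp [Matrix.smul_mulVec]

lemma mul_g_eq_zero_of_mem_Slam {ls : Fin m → ℝ} (h : ls ∈ P.Slam zstar) (i : Fin m) :
    ls i * P.g i zstar = 0 :=
  (Finset.sum_eq_zero_iff_of_nonpos fun i _ =>
    mul_nonpos_of_nonneg_of_nonpos (h.2.2.1 i) (h.2.1 i)).1 h.2.2.2 i (Finset.mem_univ i)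

lemma eq_zero_of_mem_Slam {ls : Fin m → ℝ} (h : ls ∈ P.Slam zstar) {i : Fin m}
    (hi : P.g i zstar ≠ 0) : ls i = 0 :=
  (mul_eq_zero.1 (mul_g_eq_zero_of_mem_Slam h i)).resolve_right hi

lemma midpoint_mem_Slam {ls ls' : Fin m → ℝ} (h : ls ∈ P.Slam zstar)
    (h' : ls' ∈ P.Slam zstar) : (1 / 2 : ℝ) • (ls + ls') ∈ P.Slam zstar := by
  refine ⟨?_, h.2.1, fun i => ?_, Finset.sum_eq_zero fun i _ => ?_⟩
  · ext j
    have h1 := congrFun h.1 j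
    have h2 := congrFun h'.1 j
    simp only [Lz, Pi.zero_apply] at h1 h2
    have h3 : ∑ i, ((1 / 2 : ℝ) • (ls + ls')) i * P.gradg i zstar j =
        (∑ i, ls i * P.gradg i zstar j + ∑ i, ls' i * P.gradg i zstar j) / 2 := by
      rw [← Finset.sum_add_distrib, Finset.sum_div]
      refine Finset.sum_congr rfl fun i _ => ?_
      simp
      ring
    simp only [Lz, Pi.zero_apply]
    rw [h3]
    linarith
  · have := h.2.2.1 i
    have := h'.2.2.1 i
    simp
    linarith
  · have h1 := mul_g_eq_zero_of_mem_Slam h i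
    have h2 := mul_g_eq_zero_of_mem_Slam h' i
    simp only [Pi.smul_apply, Pi.add_apply, smul_eq_mul]
    linarith

lemma exists_strict_multiplier (hsol : P.isSolution zstar) (hsc : P.StrictComp zstar) :
    ∃ ls ∈ P.Slam zstar, ∀ i, P.g i zstar = 0 → 0 < ls i := by
  suffices h : ∀ T : Finset (Fin m), ∃ ls ∈ P.Slam zstar, ∀ i ∈ T, P.g i zstar = 0 → 0 < ls i by
    obtain ⟨ls, h1, h2⟩ := h Finset.univ
    exact ⟨ls, h1, fun i => h2 i (Finset.mem_univ i)⟩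
  intro T
  induction T using Finset.induction_on with
  | empty =>
    obtain ⟨ls, h⟩ := hsol.2.1
    exact ⟨ls, h, by simp⟩
  | insert i T _ ih =>
    obtain ⟨ls, h1, h2⟩ := ih
    by_cases hi : P.g i zstar = 0
    · obtain ⟨-, ls', h1', h2'⟩ := hsc i hi
      refine ⟨_, midpoint_mem_Slam h1 h1', fun j hj hgj => ?_⟩
      have p1 := h1.2.2.1 j
      have p2 := h1'.2.2.1 j
      simp only [Pi.smul_apply, Pi.add_apply, smul_eq_mul]
      rcases Finset.mem_insert.1 hj with rfl | hj
      · linarith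
      · linarith [h2 j hj hgj]
    · refine ⟨ls, h1, fun j hj hgj => ?_⟩
      rcases Finset.mem_insert.1 hj with rfl | hj
      · exact absurd hgj hi
      · exact h2 j hj hgj

lemma continuous_g (i : Fin m) : Continuous (P.g i) :=
  continuous_iff_continuousAt.2 fun z => (P.grad_g i z).continuousAt

lemma isCompact_Slam (hmfcq : P.MFCQ zstar) : IsCompact (P.Slam zstar) := by
  refine Metric.isCompact_of_isClosed_isBounded ?_ ?_
  · have : P.Slam zstar = {lam | P.Lz zstar lam = 0} ∩ ({_lam | ∀ i, P.g i zstar ≤ 0} ∩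
        ({lam | ∀ i, 0 ≤ lam i} ∩ {lam | ∑ i, lam i * P.g i zstar = 0})) := rfl
    rw [this]
    refine IsClosed.inter ?_ (IsClosed.inter isClosed_const (IsClosed.inter ?_ ?_))
    · refine isClosed_eq ?_ continuous_const
      unfold Lz
      fun_prop
    · simp only [Set.ofPred_forall]
      exact isClosed_iInter fun i => isClosed_le continuous_const (by fun_prop)
    · exact isClosed_eq (by fun_prop) continuous_const
  · obtain ⟨y, hy⟩ := hmfcq
    let c : Fin m → ℝ := fun i => (P.gradphi zstar ⬝ᵥ y) / -(P.gradg i zstar ⬝ᵥ y)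
    refine isBounded_iff_forall_norm_le.2 ⟨‖c‖, fun ls h => ?_⟩
    refine (pi_norm_le_iff_of_nonneg (norm_nonneg _)).2 fun i => ?_
    by_cases hi : P.g i zstar = 0
    · refine le_trans ?_ (norm_le_pi_norm c i)
      rw [Real.norm_eq_abs, Real.norm_eq_abs, abs_of_nonneg (h.2.2.1 i)]
      refine le_trans ?_ (le_abs_self _)
      have hyi : P.gradg i zstar ⬝ᵥ y < 0 := hy i hi
      simp only [c]
      rw [le_div_iff₀ (by linarith)]
      have h0 : P.gradphi zstar ⬝ᵥ y + ∑ i, ls i * (P.gradg i zstar ⬝ᵥ y) = 0 := by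
        rw [← Lz_dotProduct, h.1, zero_dotProduct]
      have h1 : ∑ j, -(ls j * (P.gradg j zstar ⬝ᵥ y)) = P.gradphi zstar ⬝ᵥ y := by
        rw [Finset.sum_neg_distrib]
        linarith
      rw [← h1, mul_neg]
      refine Finset.single_le_sum (f := fun j => -(ls j * (P.gradg j zstar ⬝ᵥ y)))
        (fun j _ => ?_) (Finset.mem_univ i)
      by_cases hj : P.g j zstar = 0
      · have : P.gradg j zstar ⬝ᵥ y < 0 := hy j hj
        nlinarith [h.2.2.1 j]
      · simp [eq_zero_of_mem_Slam h hj]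
    · rw [eq_zero_of_mem_Slam h hi, norm_zero]
      exact norm_nonneg _

lemma eventually_lagrangian_inequality (R : ℝ) {ε : ℝ} (hε : 0 < ε) :
    ∀ᶠ z in 𝓝 zstar, ∀ lam lb : Fin m → ℝ, ‖lam‖ ≤ R → ‖lb‖ ≤ R →
      (z - zstar) ⬝ᵥ (P.Lzz zstar ((1 / 2 : ℝ) • (lam + lb))).mulVec (z - zstar)
        + ∑ i, (lam i - lb i) * (P.g i z - P.g i zstar)
      ≤ P.Lz z lam ⬝ᵥ (z - zstar) - P.Lz zstar lb ⬝ᵥ (z - zstar) + ε * ‖z - zstar‖ ^ 2 := by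
  set η : ℝ := ε / (1 + 3 * |R| * m) with hη
  have hη0 : 0 < η := by positivity
  have hphi := eventually_trapezoid P.grad_phi (P.hess_phi zstar) hη0
  have hg : ∀ᶠ z in 𝓝 zstar, ∀ i, _ :=
    eventually_all.2 fun i => eventually_trapezoid (P.grad_g i) (P.hess_g i zstar) hη0
  filter_upwards [hphi, hg] with z hphi hg lam lb hlam hlb
  rw [dotProduct_Lzz_mulVec, Lz_dotProduct, Lz_dotProduct]
  set d := z - zstar
  have hterm : ∀ i, ((1 / 2 : ℝ) • (lam + lb)) i * (d ⬝ᵥ (P.hessg i zstar).mulVec d)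
      + (lam i - lb i) * (P.g i z - P.g i zstar)
      ≤ lam i * (P.gradg i z ⬝ᵥ d) - lb i * (P.gradg i zstar ⬝ᵥ d)
        + 3 * |R| * (η * ‖d‖ ^ 2) := by
    intro i
    obtain ⟨h1, h2⟩ := hg i
    have hl : |lam i| ≤ |R| := (norm_le_pi_norm lam i).trans (hlam.trans (le_abs_self R))
    have hl' : |lb i| ≤ |R| := (norm_le_pi_norm lb i).trans (hlb.trans (le_abs_self R))
    have e1 := abs_mul ((lam i + lb i) / 2)
      (P.gradg i z ⬝ᵥ d - P.gradg i zstar ⬝ᵥ d - d ⬝ᵥ (P.hessg i zstar).mulVec d)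
    have e2 := abs_mul (lam i - lb i)
      ((P.gradg i z ⬝ᵥ d + P.gradg i zstar ⬝ᵥ d) / 2 - (P.g i z - P.g i zstar))
    have b1 : |(lam i + lb i) / 2| ≤ |R| := by
      rw [abs_le] at *
      constructor <;> linarith
    have b2 : |lam i - lb i| ≤ 2 * |R| := by
      rw [abs_le] at *
      constructor <;> linarith
    have f1 := mul_le_mul b1 h2 (abs_nonneg _) (abs_nonneg _)
    have f2 := mul_le_mul b2 h1 (abs_nonneg _) (by positivity)
    rw [← e1] at f1
    rw [← e2] at f2
    have g1 := (abs_le.1 f1).1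
    have g2 := (abs_le.1 f2).1
    simp only [Pi.smul_apply, Pi.add_apply, smul_eq_mul]
    linarith
  have hsum := Finset.sum_le_sum fun i (_ : i ∈ Finset.univ) => hterm i
  simp only [Finset.sum_add_distrib, Finset.sum_sub_distrib, Finset.sum_const,
    Finset.card_univ, Fintype.card_fin, nsmul_eq_mul] at hsum
  have hηε : η * ‖d‖ ^ 2 + m * (3 * |R| * (η * ‖d‖ ^ 2)) = ε * ‖d‖ ^ 2 := by
    have : η * (1 + 3 * |R| * m) = ε := by
      rw [hη]
      field_simp
    rw [← this]
    ring
  have := (abs_le.1 hphi.2).1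
  linarith

lemma eventually_abs_gradg_dotProduct_le {ε : ℝ} (hε : 0 < ε) :
    ∀ᶠ z in 𝓝 zstar, ∀ i, |P.gradg i zstar ⬝ᵥ (z - zstar)|
      ≤ |P.g i z - P.g i zstar| + ε * ‖z - zstar‖ := by
  refine eventually_all.2 fun i => ?_
  filter_upwards [(P.grad_g i zstar).isLittleO.def hε] with z hz
  rw [dotCLM_apply, Real.norm_eq_abs] at hz
  have := abs_sub_abs_le_abs_sub (P.gradg i zstar ⬝ᵥ (z - zstar)) (P.g i z - P.g i zstar)
  rw [abs_sub_comm] at hz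
  linarith

lemma exists_eventually_coercive (hsoc : P.SOC zstar) (hsc : P.StrictComp zstar)
    {ls : Fin m → ℝ} (hls : ls ∈ P.Slam zstar) :
    ∃ a c : ℝ, 0 < a ∧ 0 ≤ c ∧ ∀ᶠ ν in 𝓝 ls, ∀ w : Fin n → ℝ, ∀ β : ℝ, 0 ≤ β →
      (∀ i, P.g i zstar = 0 → |P.gradg i zstar ⬝ᵥ w| ≤ β) →
      a * ‖w‖ ^ 2 - c * β ^ 2 ≤ w ⬝ᵥ (P.Lzz zstar ν).mulVec w := by
  obtain ⟨ξ, hξ, hsoc⟩ := hsoc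
  let A : (Fin n → ℝ) →ₗ[ℝ] (Fin m → ℝ) := Matrix.mulVecLin
    (Matrix.of fun i => if P.g i zstar = 0 then P.gradg i zstar else 0)
  have hA : ∀ w i, A w i = if P.g i zstar = 0 then P.gradg i zstar ⬝ᵥ w else 0 := by
    intro w i
    simp only [A, Matrix.mulVecLin_apply, Matrix.mulVec, Matrix.of_apply]
    split_ifs <;> simp
  obtain ⟨k, hk, hq⟩ := A.exists_bounded_preimage
  obtain ⟨M, hM, hH⟩ := exists_abs_dotProduct_mulVec_le (P.Lzz zstar ls)
  choose N _ hHg using fun i => exists_abs_dotProduct_mulVec_le (P.hessg i zstar)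
  have hpert : ∀ᶠ ν in 𝓝 ls, ∑ i, |ν i - ls i| * N i ≤ ξ / 8 := by
    have : Tendsto (fun ν : Fin m → ℝ => ∑ i, |ν i - ls i| * N i) (𝓝 ls) (𝓝 0) := by
      have hc : Continuous fun ν : Fin m → ℝ => ∑ i, |ν i - ls i| * N i := by fun_prop
      simpa using hc.tendsto ls
    exact this.eventually_le_const (by positivity)
  refine ⟨ξ / 8, (ξ + M + 4 * M ^ 2 / ξ) * k ^ 2, by positivity, by positivity, ?_⟩
  filter_upwards [hpert] with ν hν w β hβ hw
  have hAw : ‖A w‖ ≤ β := by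
    refine (pi_norm_le_iff_of_nonneg hβ).2 fun i => ?_
    rw [hA]
    split_ifs with hi
    · exact hw i hi
    · simpa using hβ
  obtain ⟨q, hqA, hqk⟩ := hq w
  have hqβ : ‖q‖ ≤ k * β := hqk.trans (by gcongr)
  have hp0 : A (w - q) = 0 := by rw [map_sub, hqA, sub_self]
  have hQp : ξ * ‖w - q‖ ^ 2 ≤ (w - q) ⬝ᵥ (P.Lzz zstar ls).mulVec (w - q) := by
    refine le_trans ?_ (hsoc ls hls (w - q) ?_ ?_)
    · gcongr
      exact norm_le_evnorm _
    · intro i hi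
      have := congrFun hp0 i
      rw [hA, if_pos hi.1] at this
      exact this
    · intro i hi hi'
      exact absurd (hsc i hi) hi'
  have hexp : (w - q) ⬝ᵥ (P.Lzz zstar ls).mulVec (w - q) =
      w ⬝ᵥ (P.Lzz zstar ls).mulVec w - w ⬝ᵥ (P.Lzz zstar ls).mulVec q
      - q ⬝ᵥ (P.Lzz zstar ls).mulVec w + q ⬝ᵥ (P.Lzz zstar ls).mulVec q := by
    rw [Matrix.mulVec_sub, sub_dotProduct, dotProduct_sub, dotProduct_sub]
    ring
  have hdiff : |w ⬝ᵥ (P.Lzz zstar ν).mulVec w - w ⬝ᵥ (P.Lzz zstar ls).mulVec w|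
      ≤ ξ / 8 * ‖w‖ ^ 2 := by
    rw [dotProduct_Lzz_mulVec, dotProduct_Lzz_mulVec, add_sub_add_left_eq_sub,
      ← Finset.sum_sub_distrib]
    calc _ ≤ ∑ i, |ν i * (w ⬝ᵥ (P.hessg i zstar).mulVec w)
              - ls i * (w ⬝ᵥ (P.hessg i zstar).mulVec w)| := Finset.abs_sum_le_sum_abs _ _
      _ ≤ ∑ i, |ν i - ls i| * (N i * (‖w‖ * ‖w‖)) := by
          gcongr with i
          rw [← sub_mul, abs_mul]
          exact mul_le_mul_of_nonneg_left (hHg i w w) (abs_nonneg _)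
      _ = (∑ i, |ν i - ls i| * N i) * ‖w‖ ^ 2 := by
          rw [Finset.sum_mul]
          exact Finset.sum_congr rfl fun i _ => by ring
      _ ≤ _ := by gcongr
  have hwq := abs_le.1 (hH w q)
  have hqw := abs_le.1 (hH q w)
  have hqq := abs_le.1 (hH q q)
  have hdiff := abs_le.1 hdiff
  have htri : ‖w‖ ≤ ‖w - q‖ + ‖q‖ := by simpa using norm_add_le (w - q) q
  have hsq : ‖w‖ ^ 2 ≤ 2 * ‖w - q‖ ^ 2 + 2 * ‖q‖ ^ 2 := by
    nlinarith [sq_nonneg (‖w - q‖ - ‖q‖), norm_nonneg w]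
  have hq2 : ‖q‖ ^ 2 ≤ k ^ 2 * β ^ 2 := by
    rw [← mul_pow]
    gcongr
  have hy : 2 * M * (‖w‖ * ‖q‖) ≤ ξ / 4 * ‖w‖ ^ 2 + 4 * M ^ 2 / ξ * ‖q‖ ^ 2 := by
    have : ξ / 4 * ‖w‖ ^ 2 + 4 * M ^ 2 / ξ * ‖q‖ ^ 2 - 2 * M * (‖w‖ * ‖q‖)
        = (ξ * ‖w‖ / 2 - 2 * M * ‖q‖) ^ 2 / ξ := by
      field_simp
      ring
    have h0 : 0 ≤ (ξ * ‖w‖ / 2 - 2 * M * ‖q‖) ^ 2 / ξ := by positivity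
    linarith
  have hlast : (ξ + M + 4 * M ^ 2 / ξ) * ‖q‖ ^ 2
      ≤ (ξ + M + 4 * M ^ 2 / ξ) * (k ^ 2 * β ^ 2) := by gcongr
  have hξsq := mul_le_mul_of_nonneg_left hsq hξ.le
  nlinarith

section Central

variable {C gam : ℝ} {z : Fin n → ℝ} {lam s : Fin m → ℝ}

lemma central.dmu_nonneg (h : P.central C gam z lam s) : 0 ≤ dmu lam s :=
  _root_.dmu_nonneg (fun i => (h.2.2.1 i).le) fun i => (h.2.2.2.1 i).le

lemma central.norm_Lz_le (h : P.central C gam z lam s) : ‖P.Lz z lam‖ ≤ C * dmu lam s :=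
  (norm_le_evnorm _).trans h.1

lemma central.Lz_dotProduct_le (h : P.central C gam z lam s) (w : Fin n → ℝ) :
    P.Lz z lam ⬝ᵥ w ≤ n * (C * dmu lam s * ‖w‖) := by
  refine (le_abs_self _).trans ((abs_dotProduct_le _ _).trans ?_)
  rw [Fintype.card_fin]
  gcongr
  exact h.norm_Lz_le

lemma central.abs_g_add_le (h : P.central C gam z lam s) (i : Fin m) :
    |P.g i z + s i| ≤ C * dmu lam s :=
  (norm_le_pi_norm (fun i => P.g i z + s i) i).trans ((norm_le_evnorm _).trans h.2.1)

end Central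

section Local

variable {C gam : ℝ} {l0 : Fin m → ℝ}

/-- Parameter triples `(z, λ, μ)`. -/
local notation "Params" => (Fin n → ℝ) × (Fin m → ℝ) × ℝ

lemma exists_eventually_slack_le (hsol : P.isSolution zstar) (hsoc : P.SOC zstar)
    (hsc : P.StrictComp zstar) (hC : 0 < C) (hl0 : l0 ∈ P.Slam zstar) :
    ∃ K : ℝ, 0 < K ∧ ∀ᶠ p : Params in 𝓝 (zstar, l0, 0), ∀ s, P.central C gam p.1 p.2.1 s →
      dmu p.2.1 s = p.2.2 → ∀ i, P.g i zstar = 0 → s i ≤ K * p.2.2 := by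
  obtain ⟨lh, hlh, hlhpos⟩ := exists_strict_multiplier hsol hsc
  obtain ⟨κ, hκ, hκle⟩ := exists_pos_forall_le
    (f := fun i => if P.g i zstar = 0 then lh i else 1)
    (fun i => by
      show 0 < (if P.g i zstar = 0 then lh i else 1)
      split_ifs with hi
      · exact hlhpos i hi
      · exact one_pos)
  obtain ⟨a, c, ha, hc, hcoer⟩ := exists_eventually_coercive hsoc hsc (midpoint_mem_Slam hl0 hlh)
  obtain ⟨ε, hε, hcε⟩ := exists_pos_mul_sq_le (c := 3 * c) (a := a / 4) (by positivity)
    (by positivity)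
  set R := ‖l0‖ + ‖lh‖ + 1 with hR
  have hR0 : 0 < R := by positivity
  have tz : Tendsto (fun p : Params => p.1) (𝓝 (zstar, l0, 0)) (𝓝 zstar) :=
    continuous_fst.tendsto (zstar, l0, (0 : ℝ))
  have tl : Tendsto (fun p : Params => p.2.1) (𝓝 (zstar, l0, 0)) (𝓝 l0) :=
    (continuous_fst.comp continuous_snd).tendsto (zstar, l0, (0 : ℝ))
  have tt : Tendsto (fun p : Params => p.2.2) (𝓝 (zstar, l0, 0)) (𝓝 0) :=
    (continuous_snd.comp continuous_snd).tendsto (zstar, l0, (0 : ℝ))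
  have hcoer' := (((tl.add_const lh).const_smul (1 / 2 : ℝ))).eventually hcoer
  have hlag := tz.eventually
    (eventually_lagrangian_inequality (P := P) (zstar := zstar) R (ε := a / 4) (by positivity))
  have hgrad := tz.eventually (eventually_abs_gradg_dotProduct_le (P := P) (zstar := zstar) hε)
  have hsmall : ∀ᶠ p : Params in 𝓝 (zstar, l0, 0),
      3 * c * ∑ i, (if P.g i zstar = 0 then |P.g i p.1| + C * p.2.2 else 0) ≤ κ / 2 := by
    have hcont : Continuous fun p : Params =>
        3 * c * ∑ i, (if P.g i zstar = 0 then |P.g i p.1| + C * p.2.2 else 0) := by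
      refine continuous_const.mul (continuous_finsetSum _ fun i _ => ?_)
      split_ifs
      · have := (P.continuous_g i).comp (continuous_fst (X := Fin n → ℝ) (Y := (Fin m → ℝ) × ℝ))
        exact this.abs.add (by fun_prop)
      · exact continuous_const
    refine (hcont.tendsto (zstar, l0, (0 : ℝ))).eventually_le_const ?_
    rw [Finset.sum_eq_zero]
    · simpa using hκ
    · intro i _
      split_ifs with hi
      · simp [hi]
      · rfl
  have hd1 : ∀ᶠ p : Params in 𝓝 (zstar, l0, 0), ‖p.1 - zstar‖ ≤ 1 := by
    have := (tz.sub_const zstar).norm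
    rw [sub_self, norm_zero] at this
    exact this.eventually_le_const one_pos
  have hlR : ∀ᶠ p : Params in 𝓝 (zstar, l0, 0), ‖p.2.1‖ ≤ R :=
    tl.norm.eventually_le_const (by rw [hR]; linarith [norm_nonneg lh])
  have ht1 : ∀ᶠ p : Params in 𝓝 (zstar, l0, 0), p.2.2 ≤ 1 := tt.eventually_le_const one_pos
  set K0 := m + m * (2 * R * C) with hK0
  refine ⟨(K0 + n * C + 3 * c * C ^ 2 + 1) / (κ / 2), by positivity, ?_⟩
  filter_upwards [hcoer', hlag, hgrad, hsmall, hd1, hlR, ht1] with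
    ⟨z, lam, t⟩ hcoer hlag hgrad hsmall hd1 hlR ht1 s hcen ht
  simp only at hcoer hlag hgrad hsmall hd1 hlR ht1 hcen ht ⊢
  have ht0 : 0 ≤ t := ht ▸ hcen.dmu_nonneg
  set S := ∑ i, (if P.g i zstar = 0 then s i else 0) with hS
  have hspos := hcen.2.2.2.1
  have hS0 : 0 ≤ S := Finset.sum_nonneg fun i _ => by
    split_ifs
    · exact (hspos i).le
    · rfl
  have hsS : ∀ i, P.g i zstar = 0 → s i ≤ S := by
    intro i hi
    have := Finset.single_le_sum (f := fun i => if P.g i zstar = 0 then s i else 0)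
      (fun i _ => by
        show 0 ≤ (if P.g i zstar = 0 then s i else 0)
        split_ifs
        · exact (hspos i).le
        · rfl) (Finset.mem_univ i)
    simpa [hi] using this
  have hgs : ∀ i, |P.g i z + s i| ≤ C * t := fun i => ht ▸ hcen.abs_g_add_le i
  have hSsmall : 3 * c * S ≤ κ / 2 := by
    refine le_trans (mul_le_mul_of_nonneg_left (Finset.sum_le_sum fun i _ => ?_)
      (by positivity)) hsmall
    split_ifs
    · have h1 := (abs_le.1 (hgs i)).2
      have h2 := neg_abs_le (P.g i z)
      linarith
    · rfl
  set d := z - zstar with hd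
  have hd0 := norm_nonneg d
  have hco := hcoer d (S + C * t + ε * ‖d‖) (by positivity) (by
    intro i hi
    refine (hgrad i).trans ?_
    have h1 := abs_le.1 (hgs i)
    have h3 : |P.g i z - P.g i zstar| ≤ S + C * t := by
      rw [hi, sub_zero, abs_le]
      have := hsS i hi
      have := hspos i
      constructor <;> linarith
    linarith)
  have hlg := hlag lam lh hlR (by rw [hR]; linarith [norm_nonneg l0])
  rw [hlh.1, zero_dotProduct, sub_zero] at hlg
  have hLz := hcen.Lz_dotProduct_le d
  rw [ht] at hLz
  have hterm : ∀ i, -(lam i * s i) + κ * (if P.g i zstar = 0 then s i else 0) - 2 * R * C * t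
      ≤ (lam i - lh i) * (P.g i z - P.g i zstar) := by
    intro i
    have hli : |lam i| ≤ R := (norm_le_pi_norm lam i).trans hlR
    have hlhi : |lh i| ≤ R :=
      (norm_le_pi_norm lh i).trans (by rw [hR]; linarith [norm_nonneg l0])
    have b2 : |lam i - lh i| ≤ 2 * R := by
      rw [abs_le] at *
      constructor <;> linarith
    have e := mul_le_mul b2 (hgs i) (abs_nonneg _) (by positivity)
    rw [← abs_mul] at e
    have e := (abs_le.1 e).1
    have hneg : lam i * P.g i zstar ≤ 0 :=
      mul_nonpos_of_nonneg_of_nonpos (hcen.2.2.1 i).le (hsol.1 i)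
    have hz := mul_g_eq_zero_of_mem_Slam hlh i
    have hk : κ * (if P.g i zstar = 0 then s i else 0) ≤ lh i * s i := by
      have := hκle i
      split_ifs with hi
      · simp only [hi, if_true] at this
        exact mul_le_mul_of_nonneg_right this (hspos i).le
      · rw [mul_zero]
        exact mul_nonneg (hlh.2.2.1 i) (hspos i).le
    linarith
  have hsum := Finset.sum_le_sum fun i (_ : i ∈ Finset.univ) => hterm i
  rw [Finset.sum_sub_distrib, Finset.sum_add_distrib, Finset.sum_neg_distrib,
    sum_mul_eq_mul_dmu, ht, ← Finset.mul_sum, ← hS] at hsum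
  simp only [Finset.sum_const, Finset.card_univ, Fintype.card_fin, nsmul_eq_mul] at hsum
  have hsq : (S + C * t + ε * ‖d‖) ^ 2 ≤ 3 * S ^ 2 + 3 * (C * t) ^ 2 + 3 * (ε * ‖d‖) ^ 2 := by
    nlinarith [sq_nonneg (S - C * t), sq_nonneg (S - ε * ‖d‖), sq_nonneg (C * t - ε * ‖d‖)]
  have hsq' := mul_le_mul_of_nonneg_left hsq hc
  have k1 : 3 * c * S ^ 2 ≤ κ / 2 * S := by
    have := mul_le_mul_of_nonneg_right hSsmall hS0
    linarith
  have k2 : 3 * c * (C * t) ^ 2 ≤ 3 * c * C ^ 2 * t := by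
    have : t ^ 2 ≤ t := by nlinarith
    have := mul_le_mul_of_nonneg_left this (show 0 ≤ 3 * c * C ^ 2 by positivity)
    linarith
  have k3 : 3 * c * (ε * ‖d‖) ^ 2 ≤ a / 4 * ‖d‖ ^ 2 := by
    have := mul_le_mul_of_nonneg_right hcε (sq_nonneg ‖d‖)
    linarith
  have k4 : n * (C * t * ‖d‖) ≤ n * C * t := by
    have := mul_le_mul_of_nonneg_left hd1 (show 0 ≤ n * C * t by positivity)
    linarith
  have k5 : 0 ≤ a / 2 * ‖d‖ ^ 2 := by positivity
  intro i hi
  refine (hsS i hi).trans ?_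
  rw [div_mul_eq_mul_div, le_div_iff₀ (by positivity), hK0]
  linarith

lemma exists_eventually_complementarity (hsol : P.isSolution zstar) (hsoc : P.SOC zstar)
    (hsc : P.StrictComp zstar) (hC : 0 < C) (hgam : 0 < gam) (hl0 : l0 ∈ P.Slam zstar) :
    ∃ K θ : ℝ, 0 < K ∧ 0 < θ ∧ ∀ᶠ p : Params in 𝓝 (zstar, l0, 0), ∀ s,
      P.central C gam p.1 p.2.1 s → dmu p.2.1 s = p.2.2 →
      (∀ i, P.g i zstar = 0 → |P.g i p.1| ≤ K * p.2.2 ∧ θ ≤ p.2.1 i) ∧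
      ∀ i, P.g i zstar ≠ 0 → p.2.1 i ≤ K * p.2.2 := by
  obtain ⟨K, hK, hs⟩ := exists_eventually_slack_le (gam := gam) hsol hsoc hsc hC hl0
  obtain ⟨b, hb, hble⟩ := exists_pos_forall_le
    (f := fun i => if P.g i zstar = 0 then 1 else -P.g i zstar)
    (fun i => by
      show 0 < (if P.g i zstar = 0 then 1 else -P.g i zstar)
      split_ifs with hi
      · exact one_pos
      · exact neg_pos.2 (lt_of_le_of_ne (hsol.1 i) hi))
  have hsN : ∀ᶠ p : Params in 𝓝 (zstar, l0, 0), ∀ i, P.g i p.1 + C * p.2.2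
      ≤ P.g i zstar + b / 2 := by
    refine eventually_all.2 fun i => ?_
    have hcont : Continuous fun p : Params => P.g i p.1 + C * p.2.2 :=
      ((P.continuous_g i).comp continuous_fst).add (by fun_prop)
    refine (hcont.tendsto (zstar, l0, (0 : ℝ))).eventually_le_const ?_
    simpa using hb
  refine ⟨K + C + m / (b / 2), gam / K, by positivity, by positivity, ?_⟩
  filter_upwards [hs, hsN] with ⟨z, lam, t⟩ hs hsN s hcen ht
  simp only at hs hsN hcen ht ⊢
  have ht0 : 0 ≤ t := ht ▸ hcen.dmu_nonneg
  have hgs : ∀ i, |P.g i z + s i| ≤ C * t := fun i => ht ▸ hcen.abs_g_add_le i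
  have hspos := hcen.2.2.2.1
  have hlpos := hcen.2.2.1
  have hls : ∀ i, lam i * s i ≤ m * t := by
    intro i
    rw [← ht, ← sum_mul_eq_mul_dmu]
    exact Finset.single_le_sum (f := fun i => lam i * s i)
      (fun i _ => (mul_pos (hlpos i) (hspos i)).le) (Finset.mem_univ i)
  have hmb : 0 ≤ m / (b / 2) * t := by positivity
  refine ⟨fun i hi => ⟨?_, ?_⟩, fun i hi => ?_⟩
  · have h1 := abs_le.1 (hgs i)
    have h2 := hs s hcen ht i hi
    have h3 := hspos i
    have h4 : 0 ≤ C * t := by positivity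
    rw [abs_le]
    constructor <;> linarith
  · have h1 := hcen.2.2.2.2 i
    rw [ht] at h1
    have h2 := mul_le_mul_of_nonneg_left (hs s hcen ht i hi) (hlpos i).le
    have htpos : 0 < t := by
      have := (mul_pos (hlpos i) (hspos i)).trans_le (hls i)
      exact pos_of_mul_pos_right this (Nat.cast_nonneg m)
    rw [div_le_iff₀ hK]
    exact le_of_mul_le_mul_right (by linarith) htpos
  · have hbi := hble i
    simp only [hi, if_false] at hbi
    have h1 := (abs_le.1 (hgs i)).1
    have h2 := hsN i
    have h3 : b / 2 ≤ s i := by linarith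
    have h4 := mul_le_mul_of_nonneg_left h3 (hlpos i).le
    have h5 : lam i ≤ m / (b / 2) * t := by
      rw [div_mul_eq_mul_div, le_div_iff₀ (by positivity)]
      exact h4.trans (hls i)
    have h6 : 0 ≤ (K + C) * t := by positivity
    linarith

lemma exists_eventually_norm_Lz_sub_le (R : ℝ) :
    ∃ K : ℝ, 0 < K ∧ ∀ᶠ z in 𝓝 zstar, ∀ lam : Fin m → ℝ, ‖lam‖ ≤ R →
      ‖P.Lz zstar lam - P.Lz z lam‖ ≤ K * ‖z - zstar‖ := by
  obtain ⟨K1, hK1, h1⟩ := (P.hess_phi zstar).isBigO_sub.exists_pos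
  choose K2 hK2 h2 using fun i => (P.hess_g i zstar).isBigO_sub.exists_pos
  refine ⟨K1 + ∑ i, |R| * K2 i,
    add_pos_of_pos_of_nonneg hK1 (Finset.sum_nonneg fun i _ => by have := hK2 i; positivity), ?_⟩
  filter_upwards [h1.bound, eventually_all.2 fun i => (h2 i).bound] with z hz1 hz2 lam hlam
  have e : P.Lz zstar lam - P.Lz z lam =
      -((P.gradphi z - P.gradphi zstar) + ∑ i, lam i • (P.gradg i z - P.gradg i zstar)) := by
    ext j
    simp only [Lz, Pi.sub_apply, Pi.neg_apply, Pi.add_apply, Finset.sum_apply, Pi.smul_apply,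
      smul_eq_mul, mul_sub, Finset.sum_sub_distrib]
    ring
  rw [e, norm_neg, add_mul, Finset.sum_mul]
  refine (norm_add_le _ _).trans (add_le_add hz1 ((norm_sum_le _ _).trans ?_))
  gcongr with i
  rw [norm_smul, mul_assoc]
  refine mul_le_mul ?_ (hz2 i) (norm_nonneg _) (abs_nonneg _)
  exact (norm_le_pi_norm lam i).trans (hlam.trans (le_abs_self R))

lemma exists_eventually_multiplier (hsol : P.isSolution zstar) (hsoc : P.SOC zstar)
    (hsc : P.StrictComp zstar) (hC : 0 < C) (hgam : 0 < gam) (hl0 : l0 ∈ P.Slam zstar) :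
    ∃ K : ℝ, 0 < K ∧ ∀ᶠ p : Params in 𝓝 (zstar, l0, 0), ∀ s,
      P.central C gam p.1 p.2.1 s → dmu p.2.1 s = p.2.2 →
      ∃ lb ∈ P.Slam zstar, ‖p.2.1 - lb‖ ≤ K * (p.2.2 + ‖p.1 - zstar‖) := by
  obtain ⟨K1, θ, hK1, hθ, hcomp⟩ := exists_eventually_complementarity hsol hsoc hsc hC hgam hl0
  obtain ⟨K2, hK2, hLip⟩ := exists_eventually_norm_Lz_sub_le (P := P) (zstar := zstar) (‖l0‖ + 1)
  let A1 : (Fin m → ℝ) →ₗ[ℝ] (Fin n → ℝ) := (P.Gfull zstar).mulVecLin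
  let A2 : (Fin m → ℝ) →ₗ[ℝ] (Fin m → ℝ) :=
    LinearMap.pi fun i => if P.g i zstar = 0 then 0 else LinearMap.proj i
  have hA1 : ∀ v w, P.Lz zstar (v - w) = P.Lz zstar v - A1 w := by
    intro v w
    ext j
    simp only [Lz, A1, Gfull, Matrix.mulVecLin_apply, Matrix.mulVec, dotProduct, Matrix.of_apply,
      Pi.sub_apply, sub_mul, Finset.sum_sub_distrib, add_sub_assoc]
    congr 2
    exact Finset.sum_congr rfl fun i _ => mul_comm _ _
  have hA2 : ∀ v i, A2 v i = if P.g i zstar = 0 then 0 else v i := by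
    intro v i
    simp only [A2, LinearMap.pi_apply]
    split_ifs <;> rfl
  obtain ⟨k, hk, hq⟩ := (A1.prod A2).exists_bounded_preimage
  have tz : Tendsto (fun p : Params => p.1) (𝓝 (zstar, l0, 0)) (𝓝 zstar) :=
    continuous_fst.tendsto (zstar, l0, (0 : ℝ))
  have tl : Tendsto (fun p : Params => p.2.1) (𝓝 (zstar, l0, 0)) (𝓝 l0) :=
    (continuous_fst.comp continuous_snd).tendsto (zstar, l0, (0 : ℝ))
  set K := k * (C + K1 + K2) + 1 with hK
  have hK0 : 0 < K := by positivity
  have hsmall : ∀ᶠ p : Params in 𝓝 (zstar, l0, 0), K * (p.2.2 + ‖p.1 - zstar‖) ≤ θ := by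
    have hcont : Continuous fun p : Params => K * (p.2.2 + ‖p.1 - zstar‖) := by fun_prop
    refine (hcont.tendsto (zstar, l0, (0 : ℝ))).eventually_le_const ?_
    simpa using hθ
  have hlR : ∀ᶠ p : Params in 𝓝 (zstar, l0, 0), ‖p.2.1‖ ≤ ‖l0‖ + 1 :=
    tl.norm.eventually_le_const (by linarith)
  refine ⟨K, hK0, ?_⟩
  filter_upwards [hcomp, tz.eventually hLip, hsmall, hlR] with
    ⟨z, lam, t⟩ hcomp hLip hsmall hlR s hcen ht
  simp only at hcomp hLip hsmall hlR hcen ht ⊢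
  obtain ⟨hB, hN⟩ := hcomp s hcen ht
  have ht0 : 0 ≤ t := ht ▸ hcen.dmu_nonneg
  obtain ⟨q, hqA, hqk⟩ := hq (lam - l0)
  have hA1q : A1 q = A1 (lam - l0) := congrArg Prod.fst hqA
  have hA2q : A2 q = A2 (lam - l0) := congrArg Prod.snd hqA
  have hA1lam : A1 (lam - l0) = P.Lz zstar lam := by
    have := hA1 lam (lam - l0)
    rw [sub_sub_cancel, hl0.1] at this
    exact (sub_eq_zero.1 this.symm).symm
  have hLzstar : ‖P.Lz zstar lam‖ ≤ C * t + K2 * ‖z - zstar‖ := by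
    have h1 := hcen.norm_Lz_le
    have h2 := hLip lam hlR
    have h3 := norm_add_le (P.Lz z lam) (P.Lz zstar lam - P.Lz z lam)
    rw [add_sub_cancel] at h3
    rw [ht] at h1
    linarith
  have hd0 := norm_nonneg (z - zstar)
  have hA2norm : ‖A2 (lam - l0)‖ ≤ K1 * t := by
    refine (pi_norm_le_iff_of_nonneg (by positivity)).2 fun i => ?_
    rw [hA2]
    split_ifs with hi
    · rw [norm_zero]
      positivity
    · rw [Pi.sub_apply, eq_zero_of_mem_Slam hl0 hi, sub_zero, Real.norm_eq_abs,
        abs_of_pos (hcen.2.2.1 i)]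
      exact hN i hi
  have hAnorm : ‖(A1.prod A2) (lam - l0)‖ ≤ (C + K1 + K2) * (t + ‖z - zstar‖) := by
    have p1 : 0 ≤ C * ‖z - zstar‖ := by positivity
    have p2 : 0 ≤ K1 * ‖z - zstar‖ := by positivity
    have p3 : 0 ≤ K2 * ‖z - zstar‖ := by positivity
    have p4 : 0 ≤ C * t := by positivity
    have p5 : 0 ≤ K1 * t := by positivity
    have p6 : 0 ≤ K2 * t := by positivity
    rw [LinearMap.prod_apply]
    refine max_le ?_ ?_
    · show ‖A1 (lam - l0)‖ ≤ _
      rw [hA1lam]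
      linarith
    · show ‖A2 (lam - l0)‖ ≤ _
      linarith
  have hqK : ‖q‖ ≤ K * (t + ‖z - zstar‖) := by
    have h1 := mul_le_mul_of_nonneg_left hAnorm hk
    have h2 : 0 ≤ t + ‖z - zstar‖ := by positivity
    rw [hK]
    linarith
  have hN0 : ∀ i, P.g i zstar ≠ 0 → (lam - q) i = 0 := by
    intro i hi
    have := congrFun hA2q i
    rw [hA2, hA2, if_neg hi, if_neg hi, Pi.sub_apply, eq_zero_of_mem_Slam hl0 hi, sub_zero]
      at this
    rw [Pi.sub_apply, this, sub_self]
  refine ⟨lam - q, ⟨?_, hsol.1, fun i => ?_, Finset.sum_eq_zero fun i _ => ?_⟩, by simpa using hqK⟩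
  · rw [hA1, hA1q, hA1lam, sub_self]
  · by_cases hi : P.g i zstar = 0
    · have h1 := (hB i hi).2
      have h2 := (le_abs_self (q i)).trans (norm_le_pi_norm q i)
      rw [Pi.sub_apply]
      linarith
    · rw [hN0 i hi]
  · by_cases hi : P.g i zstar = 0
    · rw [hi, mul_zero]
    · rw [hN0 i hi, zero_mul]

lemma delta_le {z : Fin n → ℝ} {lam ls : Fin m → ℝ} (h : ls ∈ P.Slam zstar) :
    P.delta zstar z lam ≤ n * ‖z - zstar‖ + m * ‖lam - ls‖ := by
  refine le_trans (b := √(evnorm (z - zstar) ^ 2 + evnorm (lam - ls) ^ 2))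
    (csInf_le ⟨0, ?_⟩ ⟨ls, h, rfl⟩) ?_
  · rintro _ ⟨_, _, rfl⟩
    exact Real.sqrt_nonneg _
  · have h1 := evnorm_le_card_mul_norm (z - zstar)
    have h2 := evnorm_le_card_mul_norm (lam - ls)
    rw [Fintype.card_fin] at h1 h2
    have p1 : 0 ≤ evnorm (z - zstar) := Real.sqrt_nonneg _
    have p2 : 0 ≤ evnorm (lam - ls) := Real.sqrt_nonneg _
    refine le_trans (Real.sqrt_le_iff.2 ⟨add_nonneg p1 p2, ?_⟩) (add_le_add h1 h2)
    nlinarith [mul_nonneg p1 p2]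

lemma exists_eventually_abs_g_sub_le :
    ∃ K : ℝ, 0 < K ∧ ∀ᶠ z in 𝓝 zstar, ∀ i, |P.g i z - P.g i zstar| ≤ K * ‖z - zstar‖ := by
  choose K hK h using fun i => (P.grad_g i zstar).isBigO_sub.exists_pos
  have hsum : 0 ≤ ∑ i, K i := Finset.sum_nonneg fun i _ => (hK i).le
  refine ⟨∑ i, K i + 1, by positivity, eventually_all.2 fun i => ?_⟩
  filter_upwards [(h i).bound] with z hz
  refine hz.trans ?_
  gcongr
  have := Finset.single_le_sum (fun i _ => (hK i).le) (Finset.mem_univ i)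
  linarith

lemma exists_eventually_delta_le (hsol : P.isSolution zstar) (hsoc : P.SOC zstar)
    (hsc : P.StrictComp zstar) (hC : 0 < C) (hgam : 0 < gam) (hl0 : l0 ∈ P.Slam zstar) :
    ∃ K : ℝ, 0 < K ∧ ∀ᶠ p : Params in 𝓝 (zstar, l0, 0), ∀ s,
      P.central C gam p.1 p.2.1 s → dmu p.2.1 s = p.2.2 →
      P.delta zstar p.1 p.2.1 ≤ K * p.2.2 := by
  obtain ⟨K1, θ, hK1, hθ, hcomp⟩ := exists_eventually_complementarity hsol hsoc hsc hC hgam hl0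
  obtain ⟨K2, hK2, hmul⟩ := exists_eventually_multiplier hsol hsoc hsc hC hgam hl0
  obtain ⟨K3, hK3, hgL⟩ := exists_eventually_abs_g_sub_le (P := P) (zstar := zstar)
  obtain ⟨a, c, ha, hc, hcoer⟩ := exists_eventually_coercive hsoc hsc hl0
  obtain ⟨ε, hε, hcε⟩ := exists_pos_mul_sq_le (c := 2 * c) (a := a / 4) (by positivity)
    (by positivity)
  obtain ⟨η, hη, hball⟩ := Metric.eventually_nhds_iff.1 hcoer
  set R := ‖l0‖ + η + 1 with hR
  have hR0 : 0 < R := by positivity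
  have tz : Tendsto (fun p : Params => p.1) (𝓝 (zstar, l0, 0)) (𝓝 zstar) :=
    continuous_fst.tendsto (zstar, l0, (0 : ℝ))
  have hlag := tz.eventually
    (eventually_lagrangian_inequality (P := P) (zstar := zstar) R (ε := a / 4) (by positivity))
  have hgrad := tz.eventually (eventually_abs_gradg_dotProduct_le (P := P) (zstar := zstar) hε)
  have hsmall : ∀ᶠ p : Params in 𝓝 (zstar, l0, 0),
      ‖p.2.1 - l0‖ + K2 * (p.2.2 + ‖p.1 - zstar‖) < η := by
    have hcont : Continuous fun p : Params => ‖p.2.1 - l0‖ + K2 * (p.2.2 + ‖p.1 - zstar‖) := by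
      fun_prop
    refine (hcont.tendsto (zstar, l0, (0 : ℝ))).eventually_lt_const ?_
    simpa using hη
  set K4 := n * C + m * (K2 * K1 + K1 * K3) + 2 * c * K1 ^ 2 with hK4
  have hK40 : 0 ≤ K4 := by positivity
  set K5 := 4 * K4 / a + 1 with hK5
  have hK50 : 0 < K5 := by positivity
  refine ⟨n * K5 + m * (K2 * (1 + K5)) + 1, by positivity, ?_⟩
  filter_upwards [hcomp, hmul, tz.eventually hgL, hlag, hgrad, hsmall] with
    ⟨z, lam, t⟩ hcomp hmul hgL hlag hgrad hsmall s hcen ht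
  simp only at hcomp hmul hgL hlag hgrad hsmall hcen ht ⊢
  obtain ⟨hB, hN⟩ := hcomp s hcen ht
  obtain ⟨lb, hlb, hlbK⟩ := hmul s hcen ht
  have ht0 : 0 ≤ t := ht ▸ hcen.dmu_nonneg
  set d := z - zstar with hd
  have hd0 := norm_nonneg d
  have hl : ‖lam - l0‖ < η := by
    have : 0 ≤ K2 * (t + ‖d‖) := by positivity
    linarith
  have hlb0 : ‖lb - l0‖ < η := by
    have h1 := norm_sub_le (lam - l0) (lam - lb)
    rw [sub_sub_sub_cancel_left] at h1
    linarith
  have hmid : dist ((1 / 2 : ℝ) • (lam + lb)) l0 < η := by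
    have e : (1 / 2 : ℝ) • (lam + lb) - l0
        = (1 / 2 : ℝ) • (lam - l0) + (1 / 2 : ℝ) • (lb - l0) := by
      module
    rw [dist_eq_norm, e]
    refine (norm_add_le _ _).trans_lt ?_
    rw [norm_smul, norm_smul]
    norm_num
    linarith
  have hlR : ‖lam‖ ≤ R := by
    have h1 := norm_le_norm_add_norm_sub' lam l0
    rw [hR]
    linarith
  have hlbR : ‖lb‖ ≤ R := by
    have h1 := norm_le_norm_add_norm_sub' lb l0
    rw [hR]
    linarith
  have hco := hball hmid d (K1 * t + ε * ‖d‖) (by positivity) (by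
    intro i hi
    refine (hgrad i).trans ?_
    rw [hi, sub_zero]
    linarith [(hB i hi).1])
  have hlg := hlag lam lb hlR hlbR
  rw [hlb.1, zero_dotProduct, sub_zero] at hlg
  have hLz := hcen.Lz_dotProduct_le d
  rw [ht] at hLz
  have hterm : ∀ i, -((K2 * K1 + K1 * K3) * (t * (t + ‖d‖)))
      ≤ (lam i - lb i) * (P.g i z - P.g i zstar) := by
    intro i
    have q1 : 0 ≤ K1 * K3 * (t * (t + ‖d‖)) := by positivity
    have q2 : 0 ≤ K2 * K1 * (t * (t + ‖d‖)) := by positivity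
    have q3 : 0 ≤ K1 * K3 * (t * t) := by positivity
    by_cases hi : P.g i zstar = 0
    · have h1 : |lam i - lb i| ≤ K2 * (t + ‖d‖) := (norm_le_pi_norm (lam - lb) i).trans hlbK
      have h2 := mul_le_mul h1 (hB i hi).1 (abs_nonneg _) (by positivity)
      rw [← abs_mul] at h2
      have h3 := (abs_le.1 h2).1
      rw [hi, sub_zero]
      linarith
    · have h1 : |lam i| ≤ K1 * t := by
        rw [abs_of_pos (hcen.2.2.1 i)]
        exact hN i hi
      have h2 := mul_le_mul h1 (hgL i) (abs_nonneg _) (by positivity)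
      rw [← abs_mul] at h2
      have h3 := (abs_le.1 h2).1
      rw [eq_zero_of_mem_Slam hlb hi, sub_zero]
      linarith
  have hsum := Finset.sum_le_sum fun i (_ : i ∈ Finset.univ) => hterm i
  simp only [Finset.sum_const, Finset.card_univ, Fintype.card_fin, nsmul_eq_mul] at hsum
  have hsq : (K1 * t + ε * ‖d‖) ^ 2 ≤ 2 * (K1 * t) ^ 2 + 2 * (ε * ‖d‖) ^ 2 := by
    nlinarith [sq_nonneg (K1 * t - ε * ‖d‖)]
  have hsq' := mul_le_mul_of_nonneg_left hsq hc
  have k3 : 2 * c * (ε * ‖d‖) ^ 2 ≤ a / 4 * ‖d‖ ^ 2 := by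
    have := mul_le_mul_of_nonneg_right hcε (sq_nonneg ‖d‖)
    linarith
  have k4 : 0 ≤ n * C * (t * t) := by positivity
  have k5 : 0 ≤ 2 * c * K1 ^ 2 * (t * ‖d‖) := by positivity
  have hquad : a / 2 * ‖d‖ ^ 2 ≤ K4 * (t * (t + ‖d‖)) := by
    rw [hK4]
    linarith
  have hdK : ‖d‖ ≤ K5 * t := le_mul_of_mul_sq_le ha hK40 ht0 hquad
  refine (delta_le hlb).trans ?_
  have f1 : n * ‖d‖ ≤ n * (K5 * t) := by gcongr
  have f2 : m * ‖lam - lb‖ ≤ m * (K2 * (t + K5 * t)) := by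
    gcongr
    refine hlbK.trans ?_
    gcongr
  linarith

lemma exists_eventually_delta_le_mul_dmu (hsol : P.isSolution zstar) (hsoc : P.SOC zstar)
    (hsc : P.StrictComp zstar) (hC : 0 < C) (hgam : 0 < gam) (hl0 : l0 ∈ P.Slam zstar) :
    ∃ K : ℝ, 0 < K ∧ ∀ᶠ p : (Fin n → ℝ) × (Fin m → ℝ) in 𝓝 (zstar, l0), ∀ s,
      P.central C gam p.1 p.2 s → P.delta zstar p.1 p.2 ≤ K * dmu p.2 s := by
  obtain ⟨K, hK, h⟩ := exists_eventually_delta_le hsol hsoc hsc hC hgam hl0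
  obtain ⟨ρ, hρ, hball⟩ := Metric.eventually_nhds_iff.1 h
  refine ⟨K + (n + m : ℝ), by positivity, Metric.eventually_nhds_iff.2 ⟨ρ, hρ, ?_⟩⟩
  rintro ⟨z, lam⟩ hp s hcen
  have hμ := hcen.dmu_nonneg
  simp only at hcen hμ ⊢
  rcases lt_or_ge (dmu lam s) ρ with hlt | hge
  · have := hball (y := (z, lam, dmu lam s)) (by
      rw [Prod.dist_eq, max_lt_iff] at hp ⊢
      refine ⟨hp.1, ?_⟩
      rw [Prod.dist_eq, max_lt_iff]
      refine ⟨hp.2, ?_⟩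
      simpa [abs_of_nonneg hμ] using hlt) s hcen rfl
    simp only at this
    have h0 : 0 ≤ (n + m : ℝ) * dmu lam s := by positivity
    linarith
  · rw [Prod.dist_eq, max_lt_iff, dist_eq_norm, dist_eq_norm] at hp
    refine (delta_le hl0).trans ?_
    have h1 : n * ‖z - zstar‖ ≤ n * dmu lam s := by
      gcongr
      exact (hp.1.trans_le hge).le
    have h2 : m * ‖lam - l0‖ ≤ m * dmu lam s := by
      gcongr
      exact (hp.2.trans_le hge).le
    have h0 : 0 ≤ K * dmu lam s := by positivity
    linarith

end Local

end NLP

/-- Suppose `z*` is a solution at which MFCQ, the second-order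
condition, and strict complementarity are satisfied, and fix `C > 0`, `γ ∈ (0,1)`.
Then there exist `K > 0` and a neighborhood `W` of `S` such that every `(z,λ,s)` with
`(z,λ) ∈ W`, `λ ≥ 0`, satisfying the approximate centrality conditions with constants
`C`, `γ`, has `δ(z,λ) ≤ K·μ` with `μ = λᵀs/m`. -/
theorem stmt4_delta_le_mu
    {n m : ℕ} (P : NLP n m) (zstar : Fin n → ℝ)
    (hsol : P.isSolution zstar)
    (hmfcq : P.MFCQ zstar)
    (hsoc : P.SOC zstar)
    (hsc : P.StrictComp zstar)
    (C gam : ℝ) (hC : 0 < C) (hgam0 : 0 < gam) (hgam1 : gam < 1) :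
    ∃ K : ℝ, 0 < K ∧
      ∃ W : Set ((Fin n → ℝ) × (Fin m → ℝ)), IsOpen W ∧
        (∀ ls ∈ P.Slam zstar, (zstar, ls) ∈ W) ∧
        ∀ z : Fin n → ℝ, ∀ lam s : Fin m → ℝ,
          (z, lam) ∈ W → (∀ i, 0 ≤ lam i) → P.central C gam z lam s →
          P.delta zstar z lam ≤ K * dmu lam s := by
  obtain ⟨K, hK, h⟩ :=
    (isCompact_singleton.prod (NLP.isCompact_Slam hmfcq)).exists_eventually_nhdsSet_of_monotone
      (Q := fun K p => ∀ s, P.central C gam p.1 p.2 s → P.delta zstar p.1 p.2 ≤ K * dmu p.2 s)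
      (fun p K K' hKK' hp s hs =>
        (hp s hs).trans (mul_le_mul_of_nonneg_right hKK' hs.dmu_nonneg))
      (by
        rintro ⟨z, ls⟩ ⟨hz, hls⟩
        obtain rfl : z = zstar := hz
        exact NLP.exists_eventually_delta_le_mul_dmu hsol hsoc hsc hC hgam0 hls)
  obtain ⟨W, hWo, hSW, hW⟩ := eventually_nhdsSet_iff_exists.1 h
  exact ⟨K, hK, W, hWo, fun ls hls => hSW ⟨rfl, hls⟩,
    fun z lam s hp _ hcen => hW (z, lam) hp s hcen⟩
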